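/- Every accessible endofunctor of a cocomplete category with monic coproduct injections has arbitrarily large pre-fixpoints: for every object X there exists an object Z with HZ a subobject of Z and Z ≅ Z + X. -/

import Mathlib

open CategoryTheory CategoryTheory.Limits

universe v u

/-- A small category `J` is `κ`-filtered if every functor from a small category with
fewer than `κ` objects and fewer than `κ` morphisms admits a cocone. -/
def IsCardFiltered (κ : Cardinal.{v}) (J : Type v) [SmallCategory J] : Prop :=
  ∀ (K : Type v) [SmallCategory K], Cardinal.mk K < κ →
    Cardinal.mk (Σ a b : K, a ⟶ b) < κ →
    ∀ F : K ⥤ J, Nonempty (Limits.Cocone F)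

/-- An endofunctor is accessible if it preserves `κ`-filtered colimits for some
regular cardinal `κ`. -/
def Accessible {A : Type u} [Category.{v} A] (H : A ⥤ A) : Prop :=
  ∃ κ : Cardinal.{v}, κ.IsRegular ∧
    ∀ (J : Type v) [SmallCategory J], IsCardFiltered κ J →
      Nonempty (PreservesColimitsOfShape J H)

section Helpers

open CategoryTheory.Endofunctor

variable {A : Type u} [Category.{v} A]

/-- The cocone inducing the structure map of the colimit coalgebra. -/
noncomputable def coalgStrCocone {G : A ⥤ A} {J : Type v} [SmallCategory J] [HasColimits A]
    (F : J ⥤ Coalgebra G) : Cocone (F ⋙ Coalgebra.forget G) where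
  pt := G.obj (colimit (F ⋙ Coalgebra.forget G))
  ι :=
    { app := fun j => (F.obj j).str ≫ G.map (colimit.ι (F ⋙ Coalgebra.forget G) j)
      naturality := fun i j f => by
        have h1 := (F.map f).h
        have h2 := colimit.w (F ⋙ Coalgebra.forget G) f
        change (F.map f).f ≫ (F.obj j).str ≫ _ = (_ ≫ _) ≫ 𝟙 _
        rw [Category.comp_id, ← Category.assoc, ← h1, Category.assoc]
        exact congrArg ((F.obj i).str ≫ ·)
          ((G.map_comp _ _).symm.trans (congrArg G.map h2)) }

/-- The colimit cocone of coalgebras. -/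
noncomputable def coalgCocone {G : A ⥤ A} {J : Type v} [SmallCategory J] [HasColimits A]
    (F : J ⥤ Coalgebra G) : Cocone F where
  pt :=
    { V := colimit (F ⋙ Coalgebra.forget G)
      str := colimit.desc (F ⋙ Coalgebra.forget G) (coalgStrCocone F) }
  ι :=
    { app := fun j =>
        { f := colimit.ι (F ⋙ Coalgebra.forget G) j
          h := (colimit.ι_desc (coalgStrCocone F) j).symm }
      naturality := fun i j f => by
        apply Coalgebra.ext
        have h2 := colimit.w (F ⋙ Coalgebra.forget G) f
        change (F.map f).f ≫ _ = _ ≫ 𝟙 _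
        rw [Category.comp_id]
        exact h2 }

noncomputable def coalgCoconeIsColimit {G : A ⥤ A} {J : Type v} [SmallCategory J]
    [HasColimits A] (F : J ⥤ Coalgebra G) : IsColimit (coalgCocone F) where
  desc s :=
    { f := colimit.desc (F ⋙ Coalgebra.forget G) ((Coalgebra.forget G).mapCocone s)
      h := by
        apply colimit.hom_ext
        intro j
        have h1 := ((coalgCocone F).ι.app j).h
        have h2 := (s.ι.app j).h
        have h3 := colimit.ι_desc ((Coalgebra.forget G).mapCocone s) j
        change colimit.ι (F ⋙ Coalgebra.forget G) j ≫ (coalgCocone F).pt.str ≫ _ = _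
        erw [← reassoc_of% h1, ← G.map_comp, h3, reassoc_of% h3]
        exact h2 }
  fac s j := by
    apply Coalgebra.ext
    exact colimit.ι_desc ((Coalgebra.forget G).mapCocone s) j
  uniq s m hm := by
    apply Coalgebra.ext
    apply colimit.hom_ext
    intro j
    refine Eq.trans ?_ (colimit.ι_desc ((Coalgebra.forget G).mapCocone s) j).symm
    exact congrArg Coalgebra.Hom.f (hm j)

theorem coalg_hasColimits [HasColimits A] (G : A ⥤ A) :
    HasColimitsOfSize.{v, v} (Coalgebra G) where
  has_colimits_of_shape _ _ :=
    { has_colimit := fun F => ⟨⟨⟨coalgCocone F, coalgCoconeIsColimit F⟩⟩⟩ }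

/-- The successor structure on coalgebras. -/
noncomputable def coalgSucc [HasColimits A] (G : A ⥤ A) :
    SmallObject.SuccStruct (Coalgebra G) where
  X₀ := ⟨⊥_ A, initial.to _⟩
  succ X := ⟨G.obj X.V, G.map X.str⟩
  toSucc X := { f := X.str, h := rfl }

theorem exists_fix [HasColimits A] (G : A ⥤ A) (J : Type v) [LinearOrder J] [OrderBot J]
    [SuccOrder J] [WellFoundedLT J] [NoMaxOrder J] [PreservesColimitsOfShape J G] :
    ∃ Z : A, Nonempty (Z ≅ G.obj Z) := by
  have := coalg_hasColimits G
  let Φ := coalgSucc G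
  let F := Φ.iterationFunctor J
  let e : ∀ j, (⟨G.obj (F.obj j).V, G.map (F.obj j).str⟩ : Coalgebra G) ⟶ F.obj (Order.succ j) :=
    fun j => (Φ.iterationFunctorObjSuccIso j (not_isMax j)).inv
  have he : ∀ j, (F.map (homOfLE (Order.le_succ j))).f = (F.obj j).str ≫ (e j).f := fun j =>
    congrArg Coalgebra.Hom.f (Φ.iterationFunctor_map_succ j (not_isMax j))
  let c := coalgCocone F
  have hc : IsColimit ((Coalgebra.forget G).mapCocone c) :=
    colimit.isColimit (F ⋙ Coalgebra.forget G)
  have hG := isColimitOfPreserves G hc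
  have hw : ∀ {i j : J} (f : i ⟶ j), (F.map f).f ≫ (c.ι.app j).f = (c.ι.app i).f := fun f =>
    congrArg Coalgebra.Hom.f (c.w f)
  have hmap : ∀ {i j k : J} (f : i ⟶ j) (g : j ⟶ k) (h : i ⟶ k),
      (F.map f).f ≫ (F.map g).f = (F.map h).f := fun f g h => by
    rw [Subsingleton.elim h (f ≫ g), F.map_comp]; rfl
  -- key fact: coalgebra maps out of the successor
  have key : ∀ (j : J) (Y : Coalgebra G) (t : F.obj (Order.succ j) ⟶ Y),
      ((e j).f ≫ t.f) ≫ Y.str = G.map ((F.map (homOfLE (Order.le_succ j))).f ≫ t.f) := by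
    intro j Y t
    have h := (e j ≫ t).h
    rw [he j, Category.assoc (F.obj j).str, G.map_comp]
    exact h.symm
  let s : Cocone ((F ⋙ Coalgebra.forget G) ⋙ G) :=
    { pt := c.pt.V
      ι :=
        { app := fun j => (e j).f ≫ (c.ι.app (Order.succ j)).f
          naturality := by
            intro j k f
            change G.map (F.map f).f ≫ (e k).f ≫ (c.ι.app (Order.succ k)).f
              = ((e j).f ≫ (c.ι.app (Order.succ j)).f) ≫ 𝟙 _
            rw [Category.comp_id]
            rcases (leOfHom f).eq_or_lt with h | h
            · subst h
              rw [Subsingleton.elim f (𝟙 j), F.map_id]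
              change G.map (𝟙 _) ≫ _ = _
              rw [G.map_id, Category.id_comp]
            · have hs : Order.succ j ≤ k := Order.succ_le_of_lt h
              have hk := key j _ (F.map (homOfLE hs))
              rw [hmap _ _ f] at hk
              rw [← hk]
              simp only [Category.assoc]
              rw [← reassoc_of% (he k), hw, hw] } }
  let β : G.obj c.pt.V ⟶ c.pt.V := hG.desc s
  have hβ : ∀ j, G.map (c.ι.app j).f ≫ β = (e j).f ≫ (c.ι.app (Order.succ j)).f := fun j =>
    hG.fac s j
  refine ⟨c.pt.V, ⟨⟨c.pt.str, β, ?_, ?_⟩⟩⟩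
  · apply hc.hom_ext
    intro j
    change (c.ι.app j).f ≫ c.pt.str ≫ β = (c.ι.app j).f ≫ 𝟙 _
    have h1 : (F.obj j).str ≫ G.map (c.ι.app j).f = (c.ι.app j).f ≫ c.pt.str := (c.ι.app j).h
    rw [← reassoc_of% h1, hβ, ← reassoc_of% (he j), hw, Category.comp_id]
  · apply hG.hom_ext
    intro j
    change G.map (c.ι.app j).f ≫ β ≫ c.pt.str = G.map (c.ι.app j).f ≫ 𝟙 _
    rw [reassoc_of% (hβ j), ← Category.assoc]
    refine (key j c.pt (c.ι.app (Order.succ j))).trans ?_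
    rw [hw, Category.comp_id]

theorem coprod_preserves [HasColimits A] (B : A) (J : Type v) [LinearOrder J] [OrderBot J] :
    PreservesColimitsOfShape J (coprod.functor.obj B) where
  preservesColimit {K} :=
    { preserves := fun {c} l => by
        have hinl : ∀ (s : Cocone (K ⋙ coprod.functor.obj B)) (j : J),
            (coprod.inl : B ⟶ B ⨿ K.obj j) ≫ s.ι.app j
              = (coprod.inl : B ⟶ B ⨿ K.obj ⊥) ≫ s.ι.app ⊥ := by
          intro s j
          rw [← s.w (homOfLE (bot_le : ⊥ ≤ j))]
          change _ = coprod.inl ≫ coprod.map (𝟙 B) _ ≫ _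
          erw [coprod.inl_map_assoc, Category.id_comp]
        let s' : ∀ (s : Cocone (K ⋙ coprod.functor.obj B)), Cocone K := fun s =>
          { pt := s.pt
            ι :=
              { app := fun j => (coprod.inr : K.obj j ⟶ B ⨿ K.obj j) ≫ s.ι.app j
                naturality := by
                  intro i j f
                  change _ = _ ≫ 𝟙 _
                  rw [← s.w f, Category.comp_id]
                  change _ = coprod.inr ≫ coprod.map (𝟙 B) _ ≫ _
                  erw [coprod.inr_map_assoc] } }
        refine ⟨⟨fun s => coprod.desc ((coprod.inl : B ⟶ B ⨿ K.obj ⊥) ≫ s.ι.app ⊥)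
          (l.desc (s' s)), ?_, ?_⟩⟩
        · intro s j
          change coprod.map (𝟙 B) (c.ι.app j) ≫ _ = _
          apply coprod.hom_ext
          · rw [coprod.inl_map_assoc, Category.id_comp, coprod.inl_desc]
            exact (hinl s j).symm
          · rw [coprod.inr_map_assoc, coprod.inr_desc]
            exact l.fac (s' s) j
        · intro s m hm
          have hm' : ∀ j, coprod.map (𝟙 B) (c.ι.app j) ≫ m = s.ι.app j := hm
          apply coprod.hom_ext
          · rw [coprod.inl_desc, ← hm']
            erw [coprod.inl_map_assoc, Category.id_comp]
            rfl
          · rw [coprod.inr_desc]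
            apply l.hom_ext
            intro j
            rw [l.fac]
            change _ = coprod.inr ≫ s.ι.app j
            rw [← hm']
            erw [coprod.inr_map_assoc]
            rfl }

/-- `∐_ℕ X` absorbs `X`. -/
theorem absorb [HasColimits A] (X : A) : ∃ B : A, Nonempty (B ≅ B ⨿ X) := by
  have : HasCountableCoproducts A := inferInstance
  let B : A := ∐ (fun _ : ℕ => X)
  let ι : ∀ n : ℕ, X ⟶ B := fun n => Sigma.ι (fun _ : ℕ => X) n
  let p : B ⟶ B ⨿ X := Sigma.desc fun n => Nat.casesOn n coprod.inr (fun m => ι m ≫ coprod.inl)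
  let q : B ⨿ X ⟶ B := coprod.desc (Sigma.desc fun n => ι (n + 1)) (ι 0)
  have hp0 : ι 0 ≫ p = coprod.inr := Sigma.ι_desc _ _
  have hp1 : ∀ m, ι (m + 1) ≫ p = ι m ≫ coprod.inl := fun m => Sigma.ι_desc _ _
  have hq : ∀ m, ι m ≫ coprod.inl ≫ q = ι (m + 1) := fun m => by
    rw [coprod.inl_desc]; exact Sigma.ι_desc _ _
  have hq0 : coprod.inr ≫ q = ι 0 := coprod.inr_desc _ _
  refine ⟨B, ⟨⟨p, q, ?_, ?_⟩⟩⟩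
  · apply Sigma.hom_ext
    intro n
    change ι n ≫ p ≫ q = ι n ≫ 𝟙 _
    rw [Category.comp_id]
    cases n with
    | zero => rw [reassoc_of% hp0, hq0]
    | succ m => rw [reassoc_of% (hp1 m), hq]
  · apply coprod.hom_ext
    · apply Sigma.hom_ext
      intro n
      change ι n ≫ coprod.inl ≫ q ≫ p = ι n ≫ coprod.inl ≫ 𝟙 _
      rw [reassoc_of% (hq n), hp1, Category.comp_id]
    · rw [reassoc_of% hq0, hp0, Category.comp_id]

theorem cardFiltered_ord (κ : Cardinal.{v}) (hκ : κ.IsRegular) :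
    IsCardFiltered κ κ.ord.ToType := by
  intro K _ _ h F
  have : Fact κ.IsRegular := ⟨hκ⟩
  have : IsCardinalFiltered κ.ord.ToType κ := inferInstance
  refine this.nonempty_cocone F ?_
  rw [hasCardinalLT_iff_cardinal_mk_lt]
  refine lt_of_le_of_lt (Cardinal.mk_le_of_injective
    (f := fun a : Arrow K => (⟨a.left, a.right, a.hom⟩ : Σ a b : K, a ⟶ b)) ?_) h
  rintro ⟨a, b, f⟩ ⟨a', b', f'⟩ h
  cases h
  rfl

end Helpers

/-- Every accessible endofunctor of a cocomplete category with monic coproduct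
injections has arbitrarily large pre-fixpoints: for every object `X` there is an
object `Z` with `H.obj Z` a subobject of `Z` and `Z ≅ Z ⨿ X`. -/
theorem stmt3 (A : Type u) [Category.{v} A] [HasColimits A] [MonoCoprod A]
    (H : A ⥤ A) (hacc : Accessible H) :
    ∀ X : A, ∃ Z : A, (∃ m : H.obj Z ⟶ Z, Mono m) ∧ Nonempty (Z ≅ Z ⨿ X) := by
  intro X
  obtain ⟨κ, hκ, hH⟩ := hacc
  obtain ⟨B, ⟨b⟩⟩ := absorb X
  obtain ⟨hpres⟩ := hH κ.ord.ToType (cardFiltered_ord κ hκ)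
  have : Nonempty κ.ord.ToType := by simpa using hκ.ne_zero
  let : OrderBot κ.ord.ToType := WellFoundedLT.toOrderBot κ.ord.ToType
  let : SuccOrder κ.ord.ToType := SuccOrder.ofLinearWellFoundedLT κ.ord.ToType
  have : NoMaxOrder κ.ord.ToType := Cardinal.noMaxOrder hκ.aleph0_le
  have := coprod_preserves B κ.ord.ToType
  obtain ⟨Z, ⟨z⟩⟩ := exists_fix (H ⋙ coprod.functor.obj B) κ.ord.ToType
  let z' : Z ≅ B ⨿ H.obj Z := z
  refine ⟨Z, ⟨coprod.inr ≫ z'.inv, inferInstance⟩, ⟨?_⟩⟩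
  exact z' ≪≫ coprod.mapIso b (Iso.refl _) ≪≫ coprod.associator _ _ _ ≪≫
    coprod.mapIso (Iso.refl _) (coprod.braiding _ _) ≪≫ (coprod.associator _ _ _).symm ≪≫
    coprod.mapIso z'.symm (Iso.refl _)
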